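/- arXiv:0706.0633 — 2 statements merged into one kernel-verified Lean document; each statement's English description precedes it below -/
import Mathlib

section
/- A Banach space X is nonreflexive if and only if there exists a continuous convex function f : X → (0,∞) such that 1/f is not representable as a difference of two continuous convex functions on X. -/
/-- A Banach space is reflexive if the canonical embedding into its double dual is
surjective. -/
def ReflexiveSpace (X : Type*) [NormedAddCommGroup X] [NormedSpace ℝ X] : Prop :=
  Function.Surjective (NormedSpace.inclusionInDoubleDual ℝ X)

/-- `h` is a d.c. function: a difference of two continuous convex functions. -/
def IsDC {X : Type*} [NormedAddCommGroup X] [NormedSpace ℝ X] (h : X → ℝ) : Prop :=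
  ∃ f g : X → ℝ, Continuous f ∧ Continuous g ∧
    ConvexOn ℝ Set.univ f ∧ ConvexOn ℝ Set.univ g ∧ h = f - g

section
variable {X : Type*} [NormedAddCommGroup X] [NormedSpace ℝ X]

theorem dc_of_dom (f k : X → ℝ) (hf : Continuous f) (hfc : ConvexOn ℝ Set.univ f)
    (hk : Continuous k) (hkc : ConvexOn ℝ Set.univ k) (hpos : ∀ x, 0 < f x)
    (hk0 : ∀ x, 0 ≤ k x) (hdom : ∀ x, 1 ≤ k x * f x ^ 2) : IsDC (fun x => 1 / f x) := by
  have hcv : ConvexOn ℝ Set.univ (fun x => (f x + k x) ^ 2 / 2) := by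
    have := ((hfc.add hkc).pow (fun x _ => add_nonneg (hpos x).le (hk0 x)) 2).smul
      (c := (1/2 : ℝ)) (by norm_num)
    refine this.congr (fun x _ => ?_)
    simp only [Pi.pow_apply, Pi.add_apply, smul_eq_mul]; ring
  refine ⟨fun x => 1 / f x + (f x + k x) ^ 2 / 2, fun x => (f x + k x) ^ 2 / 2, ?_, ?_, ?_, hcv, ?_⟩
  · exact (continuous_const.div hf (fun x => (hpos x).ne')).add (by fun_prop)
  · fun_prop
  · refine ⟨convex_univ, fun x _ y _ a b ha hb hab => ?_⟩
    have h1 := hfc.2 (Set.mem_univ x) (Set.mem_univ y) ha hb hab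
    have h2 := hkc.2 (Set.mem_univ x) (Set.mem_univ y) ha hb hab
    have h3 := hpos (a • x + b • y)
    have h4 := hdom (a • x + b • y)
    have h5 := hk0 (a • x + b • y)
    have px := hpos x
    have py := hpos y
    have kx := hk0 x
    have ky := hk0 y
    simp only [smul_eq_mul] at *
    set z := a • x + b • y
    set t := a * f x + b * f y with ht
    set s := a * k x + b * k y with hs
    have tpos : 0 < t := h3.trans_le h1
    have e1 : 1 / f z - 1 / t ≤ (t - f z) * k z := by
      have : 1 / f z - 1 / t = (t - f z) * (1 / (f z * t)) := by field_simp
      rw [this]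
      apply mul_le_mul_of_nonneg_left _ (by linarith)
      rw [div_le_iff₀ (by positivity)]
      have : k z * (f z * f z) ≤ k z * (f z * t) := by gcongr
      nlinarith
    have e2 : 1 / t ≤ a * (1 / f x) + b * (1 / f y) := by
      have := (convexOn_zpow (𝕜 := ℝ) (-1)).2 (x := f x) (y := f y) px py ha hb hab
      simpa using this
    have e3 : (t + s) ^ 2 ≤ a * (f x + k x) ^ 2 + b * (f y + k y) ^ 2 := by
      have := (Even.convexOn_pow (𝕜 := ℝ) (n := 2) (by decide)).2 (Set.mem_univ (f x + k x)) (Set.mem_univ (f y + k y)) ha hb hab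
      simp only [smul_eq_mul] at this
      refine le_trans (le_of_eq ?_) this
      rw [ht, hs]; ring
    have e4 : (t + k z) ^ 2 ≤ (t + s) ^ 2 := by gcongr
    have e5 : (t - f z) * k z ≤ ((t + k z) ^ 2 - (f z + k z) ^ 2) / 2 := by nlinarith
    nlinarith
  · ext x; simp

theorem exists_dom (a : ℕ → ℝ) (ha : ∀ n, 0 ≤ a n) : ∃ k : X → ℝ, Continuous k ∧
    ConvexOn ℝ Set.univ k ∧ (∀ x, 0 ≤ k x) ∧ ∀ (n : ℕ) x, (n:ℝ) ≤ ‖x‖ → a n ≤ k x := by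
  let g : ℕ → X → ℝ := fun n x => a n * max 0 (‖x‖ + 1 - n)
  have g0 : ∀ n x, 0 ≤ g n x := fun n x => mul_nonneg (ha n) (le_max_left _ _)
  have gz : ∀ (N : ℕ) (x : X), ‖x‖ ≤ N → ∀ n ∉ Finset.range (N + 1), g n x = 0 := by
    intro N x hx n hn
    have : (N:ℝ) + 1 ≤ n := by
      simp at hn; exact_mod_cast hn
    simp only [g]
    rw [max_eq_left (by linarith), mul_zero]
  have key : ∀ (N : ℕ) (x : X), ‖x‖ ≤ N → ∑' n, g n x = ∑ n ∈ Finset.range (N + 1), g n x :=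
    fun N x hx => tsum_eq_sum (gz N x hx)
  have gconv : ∀ n, ConvexOn ℝ Set.univ (g n) := by
    intro n
    have h1 : ConvexOn ℝ Set.univ (fun x : X => ‖x‖ + 1 - n) := by
      have := (convexOn_univ_norm (E := X)).add_const (1 - (n:ℝ))
      refine this.congr (fun x _ => ?_)
      simp only [Pi.add_apply]; ring
    have := ((convexOn_const (0:ℝ) convex_univ).sup h1).smul (ha n)
    exact this
  refine ⟨fun x => ∑' n, g n x, ?_, ?_, ?_, ?_⟩
  · rw [continuous_iff_continuousAt]
    intro x
    obtain ⟨N, hN⟩ := exists_nat_gt ‖x‖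
    have : ContinuousAt (fun x => ∑ n ∈ Finset.range (N + 1), g n x) x := by
      apply Continuous.continuousAt
      simp only [g]
      fun_prop
    refine this.congr ?_
    have := (continuous_norm (E := X)).continuousAt.eventually_lt (continuousAt_const (y := (N:ℝ))) hN
    filter_upwards [this] with y hy
    exact (key N y hy.le).symm
  · refine ⟨convex_univ, fun x _ y _ b c hb hc hbc => ?_⟩
    obtain ⟨N, hN⟩ := exists_nat_gt (max ‖x‖ ‖y‖)
    have hx : ‖x‖ ≤ N := (le_max_left _ _).trans hN.le
    have hy : ‖y‖ ≤ N := (le_max_right _ _).trans hN.le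
    have hz : ‖b • x + c • y‖ ≤ N := by
      have := (convexOn_univ_norm (E := X)).2 (Set.mem_univ x) (Set.mem_univ y) hb hc hbc
      simp only [smul_eq_mul] at this
      refine this.trans ?_
      nlinarith
    simp only [key N _ hx, key N _ hy, key N _ hz, smul_eq_mul, Finset.mul_sum, ← Finset.sum_add_distrib]
    apply Finset.sum_le_sum
    intro i _
    exact (gconv i).2 (Set.mem_univ x) (Set.mem_univ y) hb hc hbc
  · intro x; exact tsum_nonneg (fun n => g0 n x)
  · intro n x hx
    obtain ⟨N, hN⟩ := exists_nat_gt ‖x‖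
    simp only
    rw [key N x hN.le]
    have : n < N + 1 := by
      have : (n:ℝ) < N := hx.trans_lt hN
      have := Nat.cast_lt.1 this
      omega
    refine le_trans ?_ (Finset.single_le_sum (f := fun n => g n x) (fun i _ => g0 i x) (Finset.mem_range.2 this))
    simp only [g]
    have h1 : (1:ℝ) ≤ max 0 (‖x‖ + 1 - n) := le_max_of_le_right (by linarith)
    nlinarith [ha n]

theorem not_dc (f : X → ℝ) (hpos : ∀ x, 0 < f x)
    (h : ∀ r > 0, ∃ w : X, ∀ ε > 0, ∃ x, ‖x - w‖ ≤ r ∧ f x < ε) : ¬ IsDC (fun x => 1 / f x) := by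
  rintro ⟨g, h', hg, hh, hgc, hhc, hgh⟩
  have e1 : ∀ᶠ x in nhds (0:X), g x < g 0 + 1 :=
    hg.continuousAt.eventually_lt continuousAt_const (by linarith)
  have e2 : ∀ᶠ x in nhds (0:X), h' x < h' 0 + 1 :=
    hh.continuousAt.eventually_lt continuousAt_const (by linarith)
  obtain ⟨ρ, hρ, hb⟩ := Metric.eventually_nhds_iff.1 (e1.and e2)
  obtain ⟨w, hw⟩ := h (ρ / 4) (by positivity)
  have mid : ∀ (F : X → ℝ), ConvexOn ℝ Set.univ F → ∀ a b z : X, (2:ℝ) • z = a + b →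
      F z ≤ F a / 2 + F b / 2 := by
    intro F hF a b z hz
    have := hF.2 (Set.mem_univ a) (Set.mem_univ b) (show (0:ℝ) ≤ 1/2 by norm_num) (show (0:ℝ) ≤ 1/2 by norm_num) (by norm_num)
    have e : (1/2:ℝ) • a + (1/2:ℝ) • b = z := by
      rw [← smul_add, ← hz, smul_smul]; norm_num
    rw [e] at this
    simp only [smul_eq_mul] at this
    linarith
  set K := g ((2:ℝ) • w) / 2 + (g 0 + 1) / 2 - 2 * h' w + h' ((2:ℝ) • w) / 2 + (h' 0 + 1) / 2 with hK
  obtain ⟨x, hx, hfx⟩ := hw (1 / (|K| + 1)) (by positivity)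
  have hn1 : dist ((2:ℝ) • (x - w)) 0 < ρ := by
    rw [dist_zero_right, norm_smul]; norm_num; linarith
  have hn2 : dist (-((2:ℝ) • (x - w))) 0 < ρ := by
    rw [dist_zero_right, norm_neg, norm_smul]; norm_num; linarith
  have b1 := (hb hn1).1
  have b2 := (hb hn2).2
  have c1 := mid g hgc ((2:ℝ) • w) ((2:ℝ) • (x - w)) x (by module)
  have c2 := mid h' hhc x ((2:ℝ) • w - x) w (by module)
  have c3 := mid h' hhc ((2:ℝ) • w) (-((2:ℝ) • (x - w))) ((2:ℝ) • w - x) (by module)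
  have c4 := congrFun hgh x
  simp only [Pi.sub_apply] at c4
  have c5 : 1 / f x ≤ K := by linarith
  have c6 : |K| + 1 < 1 / f x := by
    rw [lt_div_iff₀ (hpos x)]
    rw [lt_div_iff₀ (by positivity)] at hfx
    linarith
  linarith [le_abs_self K]

theorem sum_lemma (g : ℕ → X → ℝ) (A B : ℝ) (hA : 0 ≤ A) (hc : ∀ i, Continuous (g i))
    (hcv : ∀ i, ConvexOn ℝ Set.univ (g i)) (h0 : ∀ i x, 0 ≤ g i x)
    (hb : ∀ i x, g i x ≤ A * ‖x‖ + B) :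
    ∃ G : X → ℝ, Continuous G ∧ ConvexOn ℝ Set.univ G ∧ (∀ x, 0 ≤ G x) ∧
      (∀ x, G x = 0 → ∀ i, g i x = 0) ∧
      (∀ x n, (∀ i < n, g i x = 0) → G x ≤ 2 * (1/2)^n * (A * ‖x‖ + B)) := by
  have hs : ∀ x, Summable (fun i => (1/2:ℝ)^i * g i x) := by
    intro x
    refine Summable.of_nonneg_of_le (fun i => mul_nonneg (by positivity) (h0 i x))
      (fun i => mul_le_mul_of_nonneg_left (hb i x) (by positivity)) ?_
    exact summable_geometric_two.mul_right _
  have hn : ∀ x i, 0 ≤ (1/2:ℝ)^i * g i x := fun x i => mul_nonneg (by positivity) (h0 i x)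
  refine ⟨fun x => ∑' i, (1/2:ℝ)^i * g i x, ?_, ?_, ?_, ?_, ?_⟩
  · rw [continuous_iff_continuousAt]
    intro x
    have : ContinuousOn (fun x => ∑' i, (1/2:ℝ)^i * g i x) (Metric.ball 0 (‖x‖ + 1)) := by
      refine continuousOn_tsum (u := fun i => (1/2:ℝ)^i * (A * (‖x‖ + 1) + B)) (fun i => ?_) ?_ ?_
      · exact (continuous_const.mul (hc i)).continuousOn
      · exact summable_geometric_two.mul_right _
      · intro i y hy
        rw [Real.norm_of_nonneg (hn y i)]
        apply mul_le_mul_of_nonneg_left _ (by positivity)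
        refine (hb i y).trans ?_
        have : ‖y‖ ≤ ‖x‖ + 1 := (mem_ball_zero_iff.1 hy).le
        gcongr
    exact this.continuousAt (Metric.isOpen_ball.mem_nhds (by simp))
  · refine ⟨convex_univ, fun x _ y _ b c hb hc hbc => ?_⟩
    simp only [smul_eq_mul]
    rw [← tsum_mul_left, ← tsum_mul_left, ← ((hs x).mul_left b).tsum_add ((hs y).mul_left c)]
    refine (hs _).tsum_le_tsum (fun i => ?_) (((hs x).mul_left b).add ((hs y).mul_left c))
    have := (hcv i).2 (Set.mem_univ x) (Set.mem_univ y) hb hc hbc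
    simp only [smul_eq_mul] at this
    have h2 : (0:ℝ) ≤ (1/2)^i := by positivity
    calc _ ≤ (1/2:ℝ)^i * (b * g i x + c * g i y) := mul_le_mul_of_nonneg_left this h2
      _ = _ := by ring
  · exact fun x => tsum_nonneg (hn x)
  · intro x hx i
    have := (hs x).le_tsum i (fun j _ => hn x j)
    simp only at hx
    rw [hx] at this
    have h2 : (0:ℝ) < (1/2)^i := by positivity
    have h3 := h0 i x
    by_contra h4
    have : 0 < g i x := lt_of_le_of_ne h3 (Ne.symm h4)
    have := mul_pos h2 this
    linarith
  · intro x n hx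
    simp only
    rw [← (hs x).sum_add_tsum_nat_add n]
    rw [Finset.sum_eq_zero (fun i hi => by rw [hx i (Finset.mem_range.1 hi), mul_zero]), zero_add]
    have hs' : Summable (fun i => (1/2:ℝ)^i * ((1/2)^n * (A * ‖x‖ + B))) :=
      summable_geometric_two.mul_right _
    calc _ ≤ ∑' i, (1/2:ℝ)^i * ((1/2)^n * (A * ‖x‖ + B)) := by
          refine ((summable_nat_add_iff n).2 (hs x)).tsum_le_tsum (fun i => ?_) hs'
          rw [pow_add, mul_assoc]
          gcongr
          exact hb _ _
      _ = _ := by rw [tsum_mul_right, tsum_geometric_two]; ring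

open NormedSpace

theorem refl_bound (hX : Function.Surjective (NormedSpace.inclusionInDoubleDual ℝ X))
    (f : X → ℝ) (hf : Continuous f) (hfc : ConvexOn ℝ Set.univ f)
    (hpos : ∀ x, 0 < f x) (R : ℝ) : ∃ c > 0, ∀ x, ‖x‖ ≤ R → c ≤ f x := by
  by_contra! hcon
  choose x hxR hx using fun n : ℕ => hcon (1 / ((n:ℝ) + 1)) (by positivity)
  let T : X → WeakDual ℝ (StrongDual ℝ X) :=
    fun y => StrongDual.toWeakDual (inclusionInDoubleDual ℝ X y)
  have hcpt := WeakDual.isCompact_closedBall (𝕜 := ℝ) (E := StrongDual ℝ X) 0 R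
  obtain ⟨ξ, _, hξ⟩ := hcpt.exists_mapClusterPt (f := Filter.atTop) (u := fun n => T (x n)) (by
    rw [Filter.map_le_iff_le_comap, ← Filter.map_le_iff_le_comap, Filter.le_principal_iff, Filter.mem_map]
    refine Filter.Eventually.of_forall (fun n => ?_)
    simp only [Set.mem_preimage, mem_closedBall_zero_iff]
    exact (double_dual_bound ℝ X (x n)).trans (hxR n))
  obtain ⟨z, hz⟩ := hX (WeakDual.toStrongDual ξ)
  have key : ∀ n : ℕ, f z ≤ 1 / ((n:ℝ) + 1) := by
    intro n
    by_contra hn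
    have hS : Convex ℝ {y | f y ≤ 1 / ((n:ℝ) + 1)} := by
      simpa using hfc.convex_le (1 / ((n:ℝ) + 1))
    have hSc : IsClosed {y | f y ≤ 1 / ((n:ℝ) + 1)} := isClosed_le hf continuous_const
    obtain ⟨φ, u, h1, h2⟩ := geometric_hahn_banach_point_closed hS hSc hn
    have h3 : MapClusterPt (φ z) Filter.atTop (fun n => φ (x n)) := by
      have hc : Continuous (fun ζ : WeakDual ℝ (StrongDual ℝ X) => ζ φ) := WeakDual.eval_continuous φ
      have := hξ.continuousAt_comp hc.continuousAt
      have e : ξ φ = φ z := by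
        have := DFunLike.congr_fun hz φ
        exact this.symm
      rw [e] at this
      exact this
    have h4 := h3.frequently (Iio_mem_nhds h1)
    obtain ⟨m, hm, hm'⟩ := (h4.and_eventually (Filter.eventually_ge_atTop n)).exists
    have : f (x m) ≤ 1 / ((n:ℝ) + 1) := by
      refine (hx m).le.trans ?_
      gcongr
    have := h2 _ this
    exact lt_asymm this hm
  obtain ⟨n, hn⟩ := exists_nat_one_div_lt (hpos z)
  linarith [key n]

theorem gen1 {E : Type*} [NormedAddCommGroup E] [NormedSpace ℝ E] (S : Set E) (hS : IsClosed S)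
    (ξ : E) (h : ξ ∉ S) : ∃ θ > 0, ∀ s ∈ S, θ ≤ ‖ξ - s‖ := by
  obtain ⟨θ, hθ, hball⟩ := Metric.isOpen_iff.1 hS.isOpen_compl ξ h
  refine ⟨θ, hθ, fun s hs => ?_⟩
  by_contra hlt
  have hm : s ∈ Metric.ball ξ θ := by
    rw [mem_ball_iff_norm, norm_sub_rev]
    exact not_le.1 hlt
  exact hball hm hs

theorem gen2 {E : Type*} [NormedAddCommGroup E] [NormedSpace ℝ E] (p : Submodule ℝ E)
    (ξ : StrongDual ℝ E) (c : ℝ) (hc : 0 ≤ c) (h : ∀ φ ∈ p, |ξ φ| ≤ c * ‖φ‖) :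
    ∃ ζ : StrongDual ℝ E, (∀ y ∈ p, ζ y = ξ y) ∧ ‖ζ‖ ≤ c := by
  let η : StrongDual ℝ p := ξ.comp p.subtypeL
  have hη : ‖η‖ ≤ c := by
    apply ContinuousLinearMap.opNorm_le_bound _ hc
    intro y
    exact h y y.2
  obtain ⟨ζ, hζ, hζn⟩ := exists_extension_norm_eq p η
  exact ⟨ζ, fun y hy => hζ ⟨y, hy⟩, hζn.trans_le hη⟩

theorem lemA (ξ : StrongDual ℝ (StrongDual ℝ X)) [CompleteSpace X]
    (hξ : ξ ∉ Set.range (inclusionInDoubleDual ℝ X)) :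
    ∃ C : ℝ, 0 < C ∧ ∀ F : Finset X, ∃ φ : StrongDual ℝ X, ‖φ‖ ≤ C ∧ ξ φ = 3 ∧ ∀ x ∈ F, φ x = 0 := by
  have hcl : IsClosed (Set.range (inclusionInDoubleDual ℝ X)) :=
    Topology.IsClosedEmbedding.isClosed_range
      (Isometry.isClosedEmbedding (f := inclusionInDoubleDual ℝ X)
        (inclusionInDoubleDualLi (𝕜 := ℝ) (E := X)).isometry)
  obtain ⟨θ, hθ, hball⟩ := gen1 _ hcl ξ hξ
  refine ⟨3 / (θ / 2), by positivity, fun F => ?_⟩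
  let L : F → StrongDual ℝ X →ₗ[ℝ] ℝ := fun x => (inclusionInDoubleDual ℝ X x).toLinearMap
  let p : Submodule ℝ (StrongDual ℝ X) := ⨅ i, LinearMap.ker (L i)
  have hp : ∃ φ ∈ p, θ / 2 * ‖φ‖ < |ξ φ| := by
    by_contra! hcon
    obtain ⟨ζ, hζ, hζn⟩ := gen2 p ξ (θ / 2) (by positivity) hcon
    have : (ξ - ζ).toLinearMap ∈ Submodule.span ℝ (Set.range L) := by
      apply mem_span_of_iInf_ker_le_ker
      intro y hy
      have := hζ y hy
      simp [this]
    have hmem : ∃ y, ξ - ζ = inclusionInDoubleDual ℝ X y := by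
      obtain ⟨c, hc⟩ := (Submodule.mem_span_range_iff_exists_fun ℝ).1 this
      refine ⟨∑ i, c i • (i : X), ?_⟩
      ext φ
      have := LinearMap.congr_fun hc φ
      simp only [LinearMap.sum_apply, LinearMap.smul_apply, L] at this
      simp only [map_sum, map_smul, sum_apply, smul_apply]
      exact this.symm
    obtain ⟨y, hy⟩ := hmem
    have h1 := hball _ ⟨y, rfl⟩
    have h2 : ξ - inclusionInDoubleDual ℝ X y = ζ := by
      rw [← hy]
      ext φ
      change ξ φ - (ξ φ - ζ φ) = ζ φ
      ring
    have h1 : θ ≤ ‖ζ‖ := h1.trans_eq (congrArg norm h2)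
    linarith
  obtain ⟨φ, hφ, hlt⟩ := hp
  have h0 : 0 < |ξ φ| := lt_of_le_of_lt (by positivity) hlt
  have h0' : ξ φ ≠ 0 := abs_pos.1 h0
  refine ⟨(3 / ξ φ) • φ, ?_, ?_, ?_⟩
  · rw [norm_smul, Real.norm_eq_abs, abs_div, div_mul_eq_mul_div, div_le_div_iff₀ h0 (by positivity)]
    rw [abs_of_pos (by norm_num : (0:ℝ) < 3)]
    nlinarith
  · rw [map_smul, smul_eq_mul]; field_simp
  · intro x hx
    have : L ⟨x, hx⟩ φ = 0 := (Submodule.mem_iInf _).1 hφ ⟨x, hx⟩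
    have : φ x = 0 := this
    simp [this]

theorem lemB (ξ : StrongDual ℝ (StrongDual ℝ X)) :
    ∀ F : Finset (StrongDual ℝ X), ∃ x : X, ‖x‖ ≤ ‖ξ‖ + 1 ∧ ∀ φ ∈ F, |φ x - ξ φ| < 1 := by
  intro F
  classical
  let T : X →L[ℝ] (F → ℝ) := ContinuousLinearMap.pi (fun φ => (φ : StrongDual ℝ X))
  let A : Set (F → ℝ) := closure (T '' Metric.closedBall 0 (‖ξ‖ + 1))
  let v : F → ℝ := fun φ => ξ φ
  have hA : Convex ℝ A := ((convex_closedBall _ _).linear_image T.toLinearMap).closure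
  have hv : v ∈ A := by
    by_contra hv
    obtain ⟨l, u, h1, h2⟩ := geometric_hahn_banach_closed_point hA isClosed_closure hv
    let ψ : StrongDual ℝ X := l.comp T
    have hl : ∀ y : F → ℝ, l y = ∑ i, y i * l (Pi.single i 1) := by
      intro y
      conv_lhs => rw [pi_eq_sum_univ' y]
      simp only [map_sum, map_smul, smul_eq_mul]
    have hψ : ψ = ∑ i : F, l (Pi.single i 1) • (i : StrongDual ℝ X) := by
      ext x
      simp only [ψ, ContinuousLinearMap.comp_apply]
      rw [hl]
      simp [T, mul_comm]
    have hξψ : ξ ψ = l v := by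
      rw [hψ, hl, map_sum]
      simp [v, mul_comm]
    have hu : ∀ x, ‖x‖ ≤ ‖ξ‖ + 1 → ψ x < u := fun x hx =>
      h1 _ (subset_closure ⟨x, by simpa using hx, rfl⟩)
    have hu0 : 0 < u := by simpa using hu 0 (by simp; positivity)
    have hn : ‖ψ‖ ≤ u / (‖ξ‖ + 1) := by
      apply ContinuousLinearMap.opNorm_le_of_unit_norm (by positivity)
      intro x hx
      have hc : ‖(‖ξ‖ + 1) • x‖ ≤ ‖ξ‖ + 1 := by
        rw [norm_smul, hx, mul_one, Real.norm_of_nonneg (by positivity)]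
      have b1 := hu _ hc
      have b2 := hu _ ((norm_neg _).trans_le hc)
      rw [map_neg] at b2
      rw [map_smul, smul_eq_mul] at b1 b2
      rw [Real.norm_eq_abs, le_div_iff₀ (by positivity), ← abs_of_pos (show 0 < ‖ξ‖ + 1 by positivity),
        ← abs_mul, abs_le]
      constructor <;> linarith
    have := (ξ.le_opNorm ψ)
    have h3 := le_abs_self (ξ ψ)
    rw [Real.norm_eq_abs] at this
    rw [le_div_iff₀ (by positivity)] at hn
    nlinarith [norm_nonneg ψ, norm_nonneg ξ]
  obtain ⟨_, ⟨x, hx, rfl⟩, hd⟩ := Metric.mem_closure_iff.1 hv 1 one_pos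
  refine ⟨x, by simpa using hx, fun φ hφ => ?_⟩
  have := (dist_le_pi_dist v (T x) ⟨φ, hφ⟩).trans_lt hd
  rw [dist_comm, Real.dist_eq] at this
  exact this

/-- auxiliary convex function -/
noncomputable def rhoAux (s y : ℝ) : ℝ := max 0 (‖(WithLp.toLp 2 (s - y, (2:ℝ)) : WithLp 2 (ℝ × ℝ))‖ - (s + y))

theorem nrm_eq (s y : ℝ) : ‖(WithLp.toLp 2 (s - y, (2:ℝ)) : WithLp 2 (ℝ × ℝ))‖ = √((s-y)^2 + 4) := by
  rw [WithLp.prod_norm_eq_of_L2]; norm_num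

theorem rho_zero_of (s y : ℝ) (hs : 0 < s) (hy : 1 ≤ s * y) : rhoAux s y = 0 := by
  have hy0 : 0 < y := by
    by_contra h
    nlinarith
  unfold rhoAux
  rw [nrm_eq]
  apply max_eq_left
  rw [sub_nonpos, Real.sqrt_le_left (by positivity)]
  nlinarith

theorem of_rho_zero (s y : ℝ) (h : rhoAux s y = 0) : 0 < s ∧ 1 ≤ s * y := by
  unfold rhoAux at h
  rw [nrm_eq] at h
  have h1 := max_eq_left_iff.1 h
  have h0 : |s - y| < √((s-y)^2 + 4) := by
    apply Real.lt_sqrt_of_sq_lt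
    rw [sq_abs]; linarith
  have h2 := abs_lt.1 (h0.trans_le (sub_nonpos.1 h1))
  have h3 := (Real.sqrt_le_left (by linarith)).1 (sub_nonpos.1 h1)
  constructor <;> nlinarith

theorem rho_bound (s y : ℝ) : rhoAux s y ≤ 2 * (|s| + |y|) + 2 := by
  unfold rhoAux
  rw [nrm_eq]
  apply max_le (by positivity)
  have : √((s-y)^2 + 4) ≤ |s - y| + 2 := by
    rw [Real.sqrt_le_left (by positivity)]
    nlinarith [sq_abs (s - y), abs_nonneg (s - y)]
  have h1 := abs_sub s y
  linarith [neg_abs_le s, neg_abs_le y]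

theorem rho_conv (φ ψ : StrongDual ℝ X) : ConvexOn ℝ Set.univ (fun x => rhoAux (φ x) (ψ x)) := by
  unfold rhoAux
  apply (convexOn_const (0:ℝ) convex_univ).sup
  refine ⟨convex_univ, fun x _ y _ a b ha hb hab => ?_⟩
  have := (convexOn_univ_norm (E := WithLp 2 (ℝ × ℝ))).2
    (Set.mem_univ (WithLp.toLp 2 (φ x - ψ x, (2:ℝ)))) (Set.mem_univ (WithLp.toLp 2 (φ y - ψ y, (2:ℝ)))) ha hb hab
  have e : a • (WithLp.toLp 2 (φ x - ψ x, (2:ℝ)) : WithLp 2 (ℝ × ℝ)) + b • WithLp.toLp 2 (φ y - ψ y, (2:ℝ))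
     = WithLp.toLp 2 (φ (a • x + b • y) - ψ (a • x + b • y), (2:ℝ)) := by
    rw [← WithLp.toLp_smul, ← WithLp.toLp_smul, ← WithLp.toLp_add]
    congr 1
    ext
    · simp; ring
    · simp; rw [← add_mul, hab, one_mul]
  rw [e] at this
  simp only [smul_eq_mul] at this
  simp only [map_add, map_smul, smul_eq_mul] at *
  linarith

theorem rho_cont (φ ψ : StrongDual ℝ X) : Continuous (fun x => rhoAux (φ x) (ψ x)) := by
  unfold rhoAux
  simp only [nrm_eq]
  fun_prop

theorem exists_seq (ξ : StrongDual ℝ (StrongDual ℝ X)) [CompleteSpace X]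
    (hξ : ξ ∉ Set.range (inclusionInDoubleDual ℝ X)) (e : X) :
    ∃ (C R : ℝ) (x : ℕ → X) (φ : ℕ → StrongDual ℝ X), 0 < C ∧ 0 < R ∧ (∀ n, ‖x n‖ ≤ R) ∧
      (∀ n, ‖φ n‖ ≤ C) ∧ (∀ n, φ n e = 0) ∧ (∀ m n, m < n → φ n (x m) = 0) ∧
      (∀ m n, m ≤ n → 2 ≤ φ m (x n)) := by
  classical
  obtain ⟨C, hC, hA⟩ := lemA ξ hξ
  have hB := lemB ξ
  obtain ⟨s, hs1, hs2⟩ := exists_seq_of_forall_finset_exists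
    (α := X × StrongDual ℝ X)
    (fun p => ‖p.1‖ ≤ ‖ξ‖ + 1 ∧ ‖p.2‖ ≤ C ∧ ξ p.2 = 3 ∧ p.2 e = 0 ∧ 2 ≤ p.2 p.1)
    (fun p q => q.2 p.1 = 0 ∧ 2 ≤ p.2 q.1) (by
      intro S hS
      obtain ⟨φ, h1, h2, h3⟩ := hA (insert e (S.image Prod.fst))
      obtain ⟨x, h4, h5⟩ := hB (insert φ (S.image Prod.snd))
      refine ⟨(x, φ), ⟨h4, h1, h2, h3 e (by simp), ?_⟩, fun p hp => ⟨?_, ?_⟩⟩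
      · have := abs_lt.1 (h5 φ (by simp))
        simp only; linarith
      · exact h3 _ (Finset.mem_insert_of_mem (Finset.mem_image_of_mem _ hp))
      · have := abs_lt.1 (h5 p.2 (Finset.mem_insert_of_mem (Finset.mem_image_of_mem _ hp)))
        have := (hS p hp).2.2.1
        simp only; linarith)
  refine ⟨C, ‖ξ‖ + 1, fun n => (s n).1, fun n => (s n).2, hC, by positivity, fun n => (hs1 n).1,
    fun n => (hs1 n).2.1, fun n => (hs1 n).2.2.2.1, fun m n h => (hs2 m n h).1, fun m n h => ?_⟩
  rcases h.eq_or_lt with rfl | h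
  · exact (hs1 m).2.2.2.2
  · exact (hs2 m n h).2

theorem exists_bad [CompleteSpace X] (hX : ¬ Function.Surjective (inclusionInDoubleDual ℝ X)) :
    ∃ f : X → ℝ, Continuous f ∧ ConvexOn ℝ Set.univ f ∧ (∀ x, 0 < f x) ∧
      ∀ r > 0, ∃ w : X, ∀ ε > 0, ∃ x, ‖x - w‖ ≤ r ∧ f x < ε := by
  obtain ⟨ξ, hξ⟩ := not_forall.1 hX
  have hnt : Nontrivial X := by
    by_contra hnt
    rw [not_nontrivial_iff_subsingleton] at hnt
    apply hξ
    refine ⟨0, ?_⟩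
    ext φ
    have : φ = 0 := by ext x; rw [Subsingleton.elim x 0]; simp
    simp [this]
  obtain ⟨e, he⟩ := exists_ne (0:X)
  obtain ⟨φ0, hφ0⟩ : ∃ φ0 : StrongDual ℝ X, φ0 e = 1 := by
    obtain ⟨g, _, hg⟩ := exists_dual_vector ℝ e (norm_ne_zero_iff.2 he)
    refine ⟨(‖e‖)⁻¹ • g, ?_⟩
    have : ‖e‖ ≠ 0 := norm_ne_zero_iff.2 he
    simp [hg, this]
  obtain ⟨C, R, x, φ, hC, hR, hxR, hφC, hφe, hφz, hφ2⟩ := exists_seq ξ hξ e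
  have hbd : ∀ i (y : X), rhoAux (φ0 y) (φ i y) ≤ (2 * (‖φ0‖ + C)) * ‖y‖ + 2 := by
    intro i y
    have h1 := φ0.le_opNorm y
    have h2 := (φ i).le_of_opNorm_le (hφC i) y
    rw [Real.norm_eq_abs] at h1 h2
    have := rho_bound (φ0 y) (φ i y)
    linarith
  obtain ⟨G, hGc, hGcv, hG0, hGz, hGb⟩ := sum_lemma (fun i y => rhoAux (φ0 y) (φ i y)) _ _ (by positivity)
    (fun i => rho_cont φ0 (φ i)) (fun i => rho_conv φ0 (φ i)) (fun i y => le_max_left _ _) hbd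
  let Y : Submodule ℝ X := Submodule.span ℝ (insert e (Set.range x))
  have hev : ∀ y ∈ Y, ∀ᶠ n in Filter.atTop, φ n y = 0 := by
    intro y hy
    refine Submodule.span_induction ?_ ?_ ?_ ?_ hy
    · rintro _ (rfl | ⟨m, rfl⟩)
      · exact Filter.Eventually.of_forall hφe
      · filter_upwards [Filter.eventually_gt_atTop m] with n hn using hφz m n hn
    · simp
    · intro a b _ _ ha hb
      filter_upwards [ha, hb] with n h1 h2
      rw [map_add, h1, h2, add_zero]
    · intro c a _ ha
      filter_upwards [ha] with n h1
      rw [map_smul, h1, smul_zero]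
  have hnc : Continuous (fun y : X => ‖Y.mkQ y‖) := by
    have : Continuous (Y.mkQ) := continuous_quot_mk
    exact this.norm
  have hncv : ConvexOn ℝ Set.univ (fun y : X => ‖Y.mkQ y‖) :=
    (convexOn_univ_norm (E := X ⧸ Y)).comp_linearMap Y.mkQ
  refine ⟨fun y => ‖Y.mkQ y‖ + G y, hnc.add hGc, hncv.add hGcv, ?_, ?_⟩
  · intro y
    by_contra hy
    have h1 : 0 ≤ ‖Y.mkQ y‖ := norm_nonneg _
    have h2 := hG0 y
    simp only at hy
    have h3 : ‖Y.mkQ y‖ = 0 := by linarith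
    have h4 := hGz y (by linarith)
    have hcl : y ∈ closure (Y : Set X) := by
      have := (QuotientAddGroup.norm_mk_eq_zero_iff_mem_closure (S := Y.toAddSubgroup) (m := y)).1 h3
      exact this
    have hs := (of_rho_zero _ _ (h4 0)).1
    have hy : ∀ i, 1 / φ0 y ≤ φ i y := fun i => by
      rw [div_le_iff₀ hs, mul_comm]
      exact (of_rho_zero _ _ (h4 i)).2
    obtain ⟨z, hz, hd⟩ := Metric.mem_closure_iff.1 hcl (1 / φ0 y / C) (by positivity)
    obtain ⟨n, hn⟩ := (hev z hz).exists
    have h5 := (φ n).le_of_opNorm_le (hφC n) (y - z)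
    rw [map_sub, hn, sub_zero] at h5
    rw [dist_eq_norm, lt_div_iff₀ hC] at hd
    have := (le_abs_self _).trans h5
    linarith [hy n]
  · intro r hr
    obtain ⟨k, hk⟩ := exists_nat_gt (R / r + 2 * ‖φ0‖ * R + 1)
    have p1 : 0 ≤ R / r := by positivity
    have p2 : 0 ≤ 2 * ‖φ0‖ * R := by positivity
    have hk1 : (1:ℝ) < k := by linarith
    have hk0 : (0:ℝ) < k := by linarith
    refine ⟨(k:ℝ) • e, fun ε hε => ?_⟩
    let M : ℝ := 2 * ((2 * (‖φ0‖ + C)) * (‖(k:ℝ) • e‖ + r) + 2)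
    have hM : 0 < M := by positivity
    obtain ⟨n, hn⟩ := exists_pow_lt_of_lt_one (div_pos hε hM) (show (1/2:ℝ) < 1 by norm_num)
    have hnorm : ‖((k:ℝ)⁻¹) • x n‖ ≤ r := by
      rw [norm_smul, norm_inv, Real.norm_of_nonneg hk0.le, inv_mul_le_iff₀ hk0]
      refine (hxR n).trans ?_
      rw [← div_le_iff₀ hr]; linarith
    refine ⟨(k:ℝ) • e + ((k:ℝ)⁻¹) • x n, by simpa using hnorm, ?_⟩
    set y := (k:ℝ) • e + ((k:ℝ)⁻¹) • x n with hy
    have hyY : y ∈ Y := by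
      apply Y.add_mem
      · exact Y.smul_mem _ (Submodule.subset_span (by simp))
      · exact Y.smul_mem _ (Submodule.subset_span (by simp))
    have h0 : ‖Y.mkQ y‖ = 0 := by
      have : Y.mkQ y = 0 := by simpa using hyY
      rw [this, norm_zero]
    have hyn : ‖y‖ ≤ ‖(k:ℝ) • e‖ + r := (norm_add_le _ _).trans (by linarith)
    have hx0 : |φ0 (x n)| ≤ ‖φ0‖ * R := (φ0.le_opNorm_of_le (hxR n))
    have hφ0y : φ0 y = k + (k:ℝ)⁻¹ * φ0 (x n) := by simp [hy, hφ0]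
    have hs : k / 2 ≤ φ0 y := by
      rw [hφ0y]
      have : (k:ℝ)⁻¹ * |φ0 (x n)| ≤ 1 * (‖φ0‖ * R) := by
        gcongr
        exact inv_le_one_of_one_le₀ hk1.le
      have h2 : -((k:ℝ)⁻¹ * |φ0 (x n)|) ≤ (k:ℝ)⁻¹ * φ0 (x n) := by
        rw [← mul_neg]
        gcongr
        exact neg_abs_le _
      linarith
    have hz : ∀ i < n, rhoAux (φ0 y) (φ i y) = 0 := by
      intro i hi
      have h1 : φ i y = (k:ℝ)⁻¹ * φ i (x n) := by simp [hy, hφe]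
      have h2 := hφ2 i n hi.le
      apply rho_zero_of
      · linarith
      · have : (k:ℝ) / 2 * ((k:ℝ)⁻¹ * 2) ≤ φ0 y * φ i y := by
          rw [h1]
          have : 0 ≤ φ0 y := by linarith
          gcongr
        have e : (k:ℝ) / 2 * ((k:ℝ)⁻¹ * 2) = 1 := by field_simp
        linarith
    have hfin := hGb y n hz
    simp only
    rw [h0, zero_add]
    calc G y ≤ _ := hfin
      _ ≤ (1/2)^n * M := by
        have : (2 * (‖φ0‖ + C)) * ‖y‖ + 2 ≤ (2 * (‖φ0‖ + C)) * (‖(k:ℝ) • e‖ + r) + 2 := by gcongr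
        have h3 : (0:ℝ) ≤ (1/2)^n := by positivity
        simp only [M]
        nlinarith
      _ < ε := by rwa [lt_div_iff₀ hM] at hn

end

theorem stmt_8 {X : Type*} [NormedAddCommGroup X] [NormedSpace ℝ X] [CompleteSpace X] :
    ¬ ReflexiveSpace X ↔
      ∃ f : X → ℝ, Continuous f ∧ ConvexOn ℝ Set.univ f ∧ (∀ x, 0 < f x) ∧
        ¬ IsDC (fun x => 1 / f x) := by
  constructor
  · intro h
    obtain ⟨f, h1, h2, h3, h4⟩ := exists_bad h
    exact ⟨f, h1, h2, h3, not_dc f h3 h4⟩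
  · rintro ⟨f, h1, h2, h3, h4⟩ hX
    apply h4
    choose c hc0 hc using fun n : ℕ => refl_bound hX f h1 h2 h3 ((n:ℝ) + 1)
    obtain ⟨k, k1, k2, k3, k4⟩ := exists_dom (X := X) (fun n => 1 / c n ^ 2) (fun n => by positivity)
    refine dc_of_dom f k h1 h2 k1 k2 h3 k3 (fun x => ?_)
    have h5 := k4 ⌊‖x‖⌋₊ x (Nat.floor_le (norm_nonneg x))
    have h6 := hc ⌊‖x‖⌋₊ x (Nat.lt_floor_add_one ‖x‖).le
    have h7 := hc0 ⌊‖x‖⌋₊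
    rw [div_le_iff₀ (by positivity)] at h5
    refine h5.trans ?_
    have := k3 x
    gcongr
end

section
/- A Banach space X is nonreflexive if and only if there exists a decreasing sequence (Cₙ) of bounded closed convex subsets of X with ⋂ₙ Cₙ = ∅ but ⋂ₙ (Cₙ + εB_X) ≠ ∅ for every ε > 0. -/
theorem aux_goldstine {Y : Type*} [NormedAddCommGroup Y] [NormedSpace ℝ Y]
    (Φ : StrongDual ℝ (StrongDual ℝ Y)) (hΦ : ‖Φ‖ ≤ 1) (s : Finset (StrongDual ℝ Y))
    (η : ℝ) (hη : 0 < η) :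
    ∃ y : Y, ‖y‖ ≤ 1 ∧ ∀ g ∈ s, |g y - Φ g| < η := by
  classical
  let T : Y →L[ℝ] (s → ℝ) := ContinuousLinearMap.pi (fun g => (g : StrongDual ℝ Y))
  let v : s → ℝ := fun g => Φ g
  by_cases hv : v ∈ closure (T '' Metric.closedBall 0 1)
  · obtain ⟨w, ⟨y, hy, rfl⟩, hd⟩ := Metric.mem_closure_iff.1 hv η hη
    refine ⟨y, by simpa using hy, fun g hg => ?_⟩
    have := (dist_le_pi_dist v (T y) ⟨g, hg⟩).trans_lt hd
    rw [dist_comm, Real.dist_eq] at this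
    exact this
  · exfalso
    obtain ⟨f, u, h1, h2⟩ := geometric_hahn_banach_closed_point
      ((convex_closedBall (0 : Y) 1).linear_image T.toLinearMap).closure isClosed_closure hv
    have hf : ∀ a : s → ℝ, f a = ∑ i, a i * f (Pi.single i 1) := by
      intro a
      conv_lhs => rw [pi_eq_sum_univ' a]
      simp [map_sum]
    let g : StrongDual ℝ Y := ∑ i : s, f (Pi.single i 1) • (i : StrongDual ℝ Y)
    have hg : ∀ y, g y = f (T y) := by
      intro y
      rw [hf]
      simp [g, T, mul_comm]
    have hgv : Φ g = f v := by
      rw [hf]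
      simp [g, v, mul_comm]
    have hb : ∀ y, ‖y‖ ≤ 1 → g y < u := fun y hy => by
      rw [hg]
      exact h1 _ (subset_closure ⟨y, by simpa using hy, rfl⟩)
    have hu : 0 < u := by simpa using hb 0 (by simp)
    have hgn : ‖g‖ ≤ u := by
      refine ContinuousLinearMap.opNorm_le_of_unit_norm hu.le (fun y hy => ?_)
      rw [Real.norm_eq_abs, abs_le]
      have e1 := hb y hy.le
      have e2 := hb (-y) (by simp [hy])
      rw [map_neg] at e2
      constructor <;> linarith
    have : Φ g ≤ u := by
      calc Φ g ≤ ‖Φ g‖ := le_abs_self _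
        _ ≤ ‖Φ‖ * ‖g‖ := Φ.le_opNorm g
        _ ≤ 1 * u := by gcongr
        _ = u := one_mul u
    linarith

theorem aux_pos {Y : Type*} [NormedAddCommGroup Y] [NormedSpace ℝ Y]
    (f : StrongDual ℝ Y) (hf : f ≠ 0) : 0 < ‖f‖ := by
  obtain ⟨y, hy⟩ : ∃ y, f y ≠ 0 := by
    by_contra! hcon
    exact hf (ContinuousLinearMap.ext hcon)
  have h1 : 0 < ‖f y‖ := norm_pos_iff.2 hy
  exact pos_of_mul_pos_left (h1.trans_le (f.le_opNorm y)) (norm_nonneg y)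

theorem aux_unit {Y : Type*} [NormedAddCommGroup Y] [NormedSpace ℝ Y]
    (f : StrongDual ℝ Y) (hf : 0 < ‖f‖) : ‖‖f‖⁻¹ • f‖ ≤ 1 := by
  refine ContinuousLinearMap.opNorm_le_bound _ zero_le_one fun y => ?_
  have h1 := f.le_opNorm y
  have h2 : (‖f‖⁻¹ • f) y = ‖f‖⁻¹ * f y := rfl
  rw [h2, norm_mul, norm_inv, norm_norm, one_mul, inv_mul_le_iff₀ hf]
  exact h1

theorem aux_sep {Y : Type*} [NormedAddCommGroup Y] [NormedSpace ℝ Y]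
    (p : Submodule ℝ (StrongDual ℝ Y)) (hp : IsClosed (p : Set (StrongDual ℝ Y)))
    (z : StrongDual ℝ Y) (hz : z ∉ p) :
    ∃ θ : ℝ, 0 < θ ∧ ∀ s : Finset (StrongDual ℝ Y), (∀ g ∈ s, g ∈ p) → ∀ η > (0 : ℝ),
      ∃ y : Y, ‖y‖ ≤ 1 ∧ |z y - θ| < η ∧ ∀ g ∈ s, |g y| < η := by
  classical
  obtain ⟨f, u, h1, h2⟩ := geometric_hahn_banach_closed_point p.convex hp
    (x := z) hz
  have hu : 0 < u := by simpa using h1 0 p.zero_mem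
  have h0 : ∀ g ∈ p, f g = 0 := by
    intro g hg
    by_contra hne
    have := h1 ((u / f g) • g) (p.smul_mem _ hg)
    rw [map_smul, smul_eq_mul, div_mul_cancel₀ _ hne] at this
    exact lt_irrefl _ this
  have hfz : 0 < f z := hu.trans h2
  have hfn : 0 < ‖f‖ := aux_pos f (by rintro rfl; simp at hfz)
  refine ⟨‖f‖⁻¹ * f z, by positivity, fun s hs η hη => ?_⟩
  obtain ⟨y, hy, hy'⟩ := aux_goldstine (‖f‖⁻¹ • f)
    (aux_unit f hfn) (insert z s) η hη
  refine ⟨y, hy, ?_, fun g hg => ?_⟩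
  · simpa using hy' z (by simp)
  · simpa [h0 g (hs g hg)] using hy' g (by simp [hg])

theorem aux_func {X : Type*} [NormedAddCommGroup X] [NormedSpace ℝ X] [CompleteSpace X]
    (h : ¬ ReflexiveSpace X) :
    ∃ ψ : StrongDual ℝ (StrongDual ℝ X), ‖ψ‖ ≤ 1 ∧ ∃ θ : ℝ, 0 < θ ∧ ∀ s : Finset X, ∀ η > (0 : ℝ),
      ∃ f : StrongDual ℝ X, ‖f‖ ≤ 1 ∧ |ψ f - θ| < η ∧ ∀ x ∈ s, |f x| < η := by
  classical
  unfold ReflexiveSpace Function.Surjective at h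
  push Not at h
  obtain ⟨z, hz⟩ := h
  let J := NormedSpace.inclusionInDoubleDual ℝ X
  have hiso : Isometry J := (NormedSpace.inclusionInDoubleDualLi (E := X) ℝ).isometry
  have hcl : IsClosed (Set.range J) := hiso.isClosedEmbedding.isClosed_range
  have hz0 : z ≠ 0 := by
    intro h0
    exact hz 0 (by rw [h0, map_zero])
  have hzn : 0 < ‖z‖ := aux_pos z hz0
  refine ⟨‖z‖⁻¹ • z, aux_unit z hzn, ?_⟩
  obtain ⟨θ, hθ, H⟩ := aux_sep (LinearMap.range J.toLinearMap)
    hcl (‖z‖⁻¹ • z) (by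
      rintro ⟨x, hx⟩
      refine hz (‖z‖ • x) ?_
      have hx' : J x = ‖z‖⁻¹ • z := hx
      show J (‖z‖ • x) = z
      rw [map_smul, hx', smul_inv_smul₀ hzn.ne'])
  refine ⟨θ, hθ, fun s η hη => ?_⟩
  obtain ⟨f, hf, hf1, hf2⟩ := H (s.image J) (by
    intro g hg
    obtain ⟨x, -, rfl⟩ := Finset.mem_image.1 hg
    exact ⟨x, rfl⟩) η hη
  exact ⟨f, hf, hf1, fun x hx => hf2 (J x) (Finset.mem_image_of_mem _ hx)⟩

theorem aux_seq {X : Type*} [NormedAddCommGroup X] [NormedSpace ℝ X] [CompleteSpace X]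
    (h : ¬ ReflexiveSpace X) :
    ∃ (c : ℝ) (f : ℕ → StrongDual ℝ X) (x : ℕ → X), 0 < c ∧ (∀ n, ‖f n‖ ≤ 1) ∧ (∀ n, ‖x n‖ ≤ 1) ∧
      (∀ j m, j ≤ m → c ≤ f j (x m)) ∧ (∀ j m, m < j → |f j (x m)| ≤ 1 / ((j : ℝ) + 1)) := by
  classical
  obtain ⟨ψ, hψ, θ, hpos, hφ⟩ := aux_func h
  obtain ⟨p, hp, hr⟩ := exists_seq_of_forall_finset_exists
    (α := ℕ × StrongDual ℝ X × X)
    (fun p => ‖p.2.1‖ ≤ 1 ∧ ‖p.2.2‖ ≤ 1 ∧ θ / 2 < ψ p.2.1 ∧ θ / 4 ≤ p.2.1 p.2.2)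
    (fun p q => p.1 < q.1 ∧ θ / 4 ≤ p.2.1 q.2.2 ∧ |q.2.1 p.2.2| ≤ 1 / ((q.1 : ℝ) + 1))
    (by
      intro s hs
      let N := s.sup (fun p => p.1) + 1
      have hN : ∀ p ∈ s, p.1 < N := fun p hp =>
        Nat.lt_succ_of_le (Finset.le_sup (f := fun p : ℕ × StrongDual ℝ X × X => p.1) hp)
      obtain ⟨f, hf, hfψ, hf'⟩ := hφ (s.image (fun p => p.2.2))
        (min (θ / 2) (1 / ((N : ℝ) + 1))) (lt_min (by positivity) (by positivity))
      have hf1 : θ / 2 < ψ f := by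
        have := hfψ.trans_le (min_le_left _ _)
        rw [abs_lt] at this
        linarith [this.1]
      obtain ⟨x, hx, hx'⟩ := aux_goldstine ψ hψ (insert f (s.image (fun p => p.2.1)))
        (θ / 4) (by positivity)
      refine ⟨(N, f, x), ⟨hf, hx, hf1, ?_⟩, fun p hp => ⟨hN p hp, ?_, ?_⟩⟩
      · have := abs_lt.1 (hx' f (by simp))
        show θ / 4 ≤ f x
        linarith [this.1]
      · have := abs_lt.1 (hx' p.2.1
          (Finset.mem_insert_of_mem (Finset.mem_image.2 ⟨p, hp, rfl⟩)))
        have h3 := (hs p hp).2.2.1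
        show θ / 4 ≤ p.2.1 x
        linarith [this.1]
      · have := (hf' p.2.2 (Finset.mem_image.2 ⟨p, hp, rfl⟩)).trans_le
            (min_le_right _ _)
        exact this.le)
  have hmono : StrictMono (fun n => (p n).1) := fun m n hmn => (hr m n hmn).1
  refine ⟨θ / 4, fun n => (p n).2.1, fun n => (p n).2.2, by positivity,
    fun n => (hp n).1, fun n => (hp n).2.1, ?_, ?_⟩
  · intro j m hjm
    rcases hjm.eq_or_lt with rfl | hlt
    · exact (hp j).2.2.2
    · exact (hr j m hlt).2.1
  · intro j m hmj
    refine (hr m j hmj).2.2.trans ?_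
    have : (j : ℝ) ≤ ((p j).1 : ℝ) := by exact_mod_cast hmono.le_apply
    gcongr

open Filter Topology in
theorem aux_tendsto {X : Type*} [NormedAddCommGroup X] [NormedSpace ℝ X]
    (f : ℕ → StrongDual ℝ X) (hf : ∀ n, ‖f n‖ ≤ 1) :
    Convex ℝ {y : X | Tendsto (fun j => f j y) atTop (𝓝 0)} ∧
    IsClosed {y : X | Tendsto (fun j => f j y) atTop (𝓝 0)} := by
  constructor
  · intro a ha b hb s t _ _ _
    have := (Tendsto.const_mul s ha).add (Tendsto.const_mul t hb)
    simpa using this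
  · refine isClosed_of_closure_subset fun y hy => ?_
    show Tendsto _ _ _
    rw [Metric.tendsto_atTop]
    intro ε hε
    obtain ⟨z, hz, hd⟩ := Metric.mem_closure_iff.1 hy (ε / 2) (half_pos hε)
    obtain ⟨N, hN⟩ := Metric.tendsto_atTop.1 hz (ε / 2) (half_pos hε)
    refine ⟨N, fun n hn => ?_⟩
    have h1 := hN n hn
    have h2 : ‖f n (y - z)‖ ≤ ‖y - z‖ := by
      simpa using (f n).le_of_opNorm_le (hf n) (y - z)
    rw [dist_eq_norm] at hd
    rw [dist_zero_right] at h1 ⊢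
    calc ‖f n y‖ = ‖f n (y - z) + f n z‖ := by rw [← map_add, sub_add_cancel]
      _ ≤ ‖f n (y - z)‖ + ‖f n z‖ := norm_add_le _ _
      _ < ε := by linarith

open Filter Topology Pointwise in
theorem aux_forward {X : Type*} [NormedAddCommGroup X] [NormedSpace ℝ X] [CompleteSpace X]
    (h : ¬ ReflexiveSpace X) :
      ∃ C : ℕ → Set X,
        (∀ n, (C n).Nonempty ∧ Bornology.IsBounded (C n) ∧ IsClosed (C n) ∧ Convex ℝ (C n)) ∧
        (∀ n, C (n + 1) ⊆ C n) ∧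
        (⋂ n, C n) = ∅ ∧
        (∀ ε > (0 : ℝ), (⋂ n, C n + Metric.closedBall (0 : X) ε).Nonempty) := by
  obtain ⟨c, f, x, hc, hf, hx, hge, hle⟩ := aux_seq h
  let e : ℕ → ℝ := fun k => 1 / ((k : ℝ) + 1)
  have he : ∀ k, 0 < e k := fun k => by simp only [e]; positivity
  have he_anti : ∀ k l, k ≤ l → e l ≤ e k := fun k l hkl => by
    have : (k : ℝ) ≤ l := by exact_mod_cast hkl
    simp only [e]; gcongr
  have he1 : ∀ k, e k ≤ 1 := fun k => by simpa [e] using he_anti 0 k (Nat.zero_le k)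
  have het : Tendsto e atTop (𝓝 0) := tendsto_one_div_add_atTop_nhds_zero_nat
  let S : ℕ → Set X := fun n => {z | ∃ k m, n ≤ m ∧ z = x k + e k • x m}
  have hS : ∀ n k, x k + e k • x n ∈ closedConvexHull ℝ (S n) :=
    fun n k => subset_closedConvexHull ⟨k, n, le_rfl, rfl⟩
  refine ⟨fun n => closedConvexHull ℝ (S n), fun n => ⟨⟨_, hS n 0⟩, ?_,
    isClosed_closedConvexHull, convex_closedConvexHull⟩, ?_, ?_, ?_⟩
  · refine (Metric.isBounded_closedBall (x := (0 : X)) (r := 2)).subset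
      (closedConvexHull_min ?_ (convex_closedBall _ _) Metric.isClosed_closedBall)
    rintro _ ⟨k, m, -, rfl⟩
    rw [mem_closedBall_zero_iff]
    have h1 : ‖e k • x m‖ ≤ 1 := by
      rw [norm_smul, Real.norm_of_nonneg (he k).le]
      exact mul_le_one₀ (he1 k) (norm_nonneg _) (hx m)
    linarith [norm_add_le (x k) (e k • x m), hx k]
  · intro n
    refine closedConvexHull_min ?_ convex_closedConvexHull isClosed_closedConvexHull
    rintro _ ⟨k, m, hm, rfl⟩
    exact subset_closedConvexHull ⟨k, m, by omega, rfl⟩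
  · rw [Set.eq_empty_iff_forall_notMem]
    intro y hy
    rw [Set.mem_iInter] at hy
    obtain ⟨t1, t2⟩ := aux_tendsto f hf
    have hxt : ∀ m, Tendsto (fun j => f j (x m)) atTop (𝓝 0) := by
      intro m
      refine squeeze_zero_norm' ?_ het
      filter_upwards [eventually_gt_atTop m] with j hj
      exact hle j m hj
    have hyt : Tendsto (fun j => f j y) atTop (𝓝 0) := by
      refine closedConvexHull_min ?_ t1 t2 (hy 0)
      rintro _ ⟨k, m, -, rfl⟩
      have := (hxt k).add (Tendsto.const_mul (e k) (hxt m))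
      simpa using this
    have key : ∀ j i, j ≤ i → c - e j - (e j)⁻¹ * e i ≤ f j y + (e j)⁻¹ * f i y := by
      intro j i hji
      have hlin : Convex ℝ {z : X | c - e j - (e j)⁻¹ * e i ≤ (f j + (e j)⁻¹ • f i) z} :=
        convex_halfSpace_ge (f j + (e j)⁻¹ • f i).isLinear _
      have hcl : IsClosed {z : X | c - e j - (e j)⁻¹ * e i ≤ (f j + (e j)⁻¹ • f i) z} :=
        isClosed_le continuous_const (f j + (e j)⁻¹ • f i).continuous
      have := closedConvexHull_min (s := S i) ?_ hlin hcl (hy i)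
      · simpa using this
      rintro _ ⟨k, m, hm, rfl⟩
      have low : ∀ l k, - e l ≤ f l (x k) := by
        intro l k
        rcases lt_or_ge k l with hkl | hkl
        · exact (abs_le.1 (hle l k hkl)).1
        · linarith [hge l k hkl, he l]
      have hjm := hge j m (hji.trans hm)
      have him := hge i m hm
      have hi := low i k
      have hinv : 0 < (e j)⁻¹ := inv_pos.2 (he j)
      have a1 : 0 ≤ e k * f j (x m) := mul_nonneg (he k).le (hc.le.trans hjm)
      have a2 : e k * c ≤ e k * f i (x m) := mul_le_mul_of_nonneg_left him (he k).le
      have a3 : (e j)⁻¹ * (- e i + e k * c) ≤ (e j)⁻¹ * (f i (x k) + e k * f i (x m)) :=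
        mul_le_mul_of_nonneg_left (by linarith) hinv.le
      show c - e j - (e j)⁻¹ * e i ≤ (f j + (e j)⁻¹ • f i) (x k + e k • x m)
      have expand : (f j + (e j)⁻¹ • f i) (x k + e k • x m) =
        f j (x k) + e k * f j (x m) + (e j)⁻¹ * (f i (x k) + e k * f i (x m)) := by
        simp
      rw [expand]
      rcases lt_or_ge k j with hkj | hkj
      · have b1 := low j k
        have b2 : 1 ≤ (e j)⁻¹ * e k := by
          rw [inv_mul_eq_div, one_le_div (he j)]
          exact he_anti k j hkj.le
        have b3 : c ≤ (e j)⁻¹ * e k * c := le_mul_of_one_le_left hc.le b2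
        linarith
      · have b1 := hge j k hkj
        have b3 : 0 ≤ (e j)⁻¹ * (e k * c) := by have := he k; positivity
        linarith [he j]
    have key2 : ∀ j, c - e j ≤ f j y := by
      intro j
      have l1 : Tendsto (fun i => c - e j - (e j)⁻¹ * e i) atTop (𝓝 (c - e j - (e j)⁻¹ * 0)) :=
        tendsto_const_nhds.sub (het.const_mul _)
      have l2 : Tendsto (fun i => f j y + (e j)⁻¹ * f i y) atTop (𝓝 (f j y + (e j)⁻¹ * 0)) :=
        tendsto_const_nhds.add (hyt.const_mul _)
      have := le_of_tendsto_of_tendsto l1 l2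
        (by filter_upwards [eventually_ge_atTop j] with i hi using key j i hi)
      simpa using this
    have l1 : Tendsto (fun j => c - e j) atTop (𝓝 (c - 0)) := tendsto_const_nhds.sub het
    have := le_of_tendsto_of_tendsto' l1 hyt key2
    linarith
  · intro ε hε
    obtain ⟨k, hk⟩ := (het.eventually (gt_mem_nhds hε)).exists
    refine ⟨x k, Set.mem_iInter.2 fun n => ?_⟩
    refine Set.mem_add.2 ⟨_, hS n k, - (e k • x n), ?_, by simp⟩
    rw [mem_closedBall_zero_iff, norm_neg, norm_smul, Real.norm_of_nonneg (he k).le]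
    calc e k * ‖x n‖ ≤ e k * 1 := mul_le_mul_of_nonneg_left (hx n) (he k).le
      _ ≤ ε := by linarith

theorem aux_backward {X : Type*} [NormedAddCommGroup X] [NormedSpace ℝ X]
    (h : ReflexiveSpace X) (C : ℕ → Set X)
    (hC : ∀ n, (C n).Nonempty ∧ Bornology.IsBounded (C n) ∧ IsClosed (C n) ∧ Convex ℝ (C n))
    (hd : ∀ n, C (n + 1) ⊆ C n) : (⋂ n, C n).Nonempty := by
  have hcl : ∀ n, IsClosed (toWeakSpace ℝ X '' C n) := by
    intro n
    have := (hC n).2.2.2.toWeakSpace_closure ℝ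
    rw [(hC n).2.2.1.closure_eq] at this
    rw [this]
    exact isClosed_closure
  have hcomp : IsCompact (toWeakSpace ℝ X '' C 0) := by
    rw [← (hcl 0).closure_eq]
    refine NormedSpace.isCompact_closure_of_isBounded ℝ X _ ?_ ?_
    · rw [Set.preimage_image_eq _ (toWeakSpace ℝ X).injective]
      exact (hC 0).2.1
    · intro z _
      obtain ⟨x, hx⟩ := h (WeakDual.toStrongDual z)
      exact ⟨toWeakSpace ℝ X x, by
        apply WeakDual.toStrongDual.injective
        rw [← hx]
        rfl⟩
  obtain ⟨z, hz⟩ := IsCompact.nonempty_iInter_of_sequence_nonempty_isCompact_isClosed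
    (fun n => toWeakSpace ℝ X '' C n) (fun n => Set.image_mono (hd n))
    (fun n => (hC n).1.image _) hcomp hcl
  rw [Set.mem_iInter] at hz
  refine ⟨(toWeakSpace ℝ X).symm z, Set.mem_iInter.2 fun n => ?_⟩
  obtain ⟨w, hw, rfl⟩ := hz n
  simpa using hw

open Pointwise in
theorem stmt_9 {X : Type*} [NormedAddCommGroup X] [NormedSpace ℝ X] [CompleteSpace X] :
    ¬ ReflexiveSpace X ↔
      ∃ C : ℕ → Set X,
        (∀ n, (C n).Nonempty ∧ Bornology.IsBounded (C n) ∧ IsClosed (C n) ∧ Convex ℝ (C n)) ∧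
        (∀ n, C (n + 1) ⊆ C n) ∧
        (⋂ n, C n) = ∅ ∧
        (∀ ε > (0 : ℝ), (⋂ n, C n + Metric.closedBall (0 : X) ε).Nonempty) := by
  constructor
  · exact aux_forward
  · rintro ⟨C, hC, hd, he, -⟩ h
    have := aux_backward h C hC hd
    rw [he] at this
    exact Set.not_nonempty_empty this
end
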